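/- Let K = ℂ((q)) be the field of formal Laurent series over ℂ, let λ = (λ_1,…,λ_n) ∈ ℤ^n, and let m = #{i : λ_i ≠ 0} with m ≥ 1. Let Cliff_q(λ) be the Clifford algebra over K of the quadratic form Q(x_1,…,x_n) = Σ_{i=1}^n ((q^{2λ_i} − q^{−2λ_i})/(q² − q^{−2})) x_i² on K^n, with its canonical ℤ/2-grading in which the generators t_i (the images of the standard basis vectors, satisfying t_i t_j + t_j t_i = 2δ_{ij}(q^{2λ_i} − q^{−2λ_i})/(q² − q^{−2})) are odd. Then: (1) there exists a finite-dimensional graded-simple graded Cliff_q(λ)-module; (2) every finite-dimensional graded-simple graded Cliff_q(λ)-module M satisfies dim_K M_0 = dim_K M_1 = 2^{⌈m/2⌉ − 1}; (3) if m is odd, then any two finite-dimensional graded-simple graded Cliff_q(λ)-modules are isomorphic as graded modules, while if m is even there are exactly two isomorphism classes of finite-dimensional graded-simple graded Cliff_q(λ)-modules. -/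

import Mathlib

noncomputable section

namespace QueerClifford

/-- The base field `K = ℂ((q))` of formal Laurent series. -/
abbrev K : Type := LaurentSeries ℂ

/-- The indeterminate `q` of `ℂ((q))`. -/
def qq : K := HahnSeries.single (1 : ℤ) (1 : ℂ)

/-- The coefficient `(q^{2λᵢ} − q^{−2λᵢ})/(q² − q^{−2})`. -/
def cw (l : ℤ) : K := (qq ^ (2 * l) - qq ^ (-(2 * l))) / (qq ^ (2 : ℤ) - qq ^ (-2 : ℤ))

/-- The quadratic form `Q(x₁,…,x_n) = Σᵢ ((q^{2λᵢ} − q^{−2λᵢ})/(q² − q^{−2})) xᵢ²` on `K^n`. -/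
def Qform (n : ℕ) (lam : Fin n → ℤ) : QuadraticForm K (Fin n → K) :=
  QuadraticMap.weightedSumSquares K (fun i => cw (lam i))

/-- A graded module over the canonically `ℤ/2`-graded Clifford algebra `Cliff_q(λ)`:
a `CliffordAlgebra Q`-module together with a decomposition `M = M₀ ⊕ M₁` (as `K`-subspaces)
such that `(evenOdd Q a) • M_b ⊆ M_{a+b}`. -/
structure GrMod {n : ℕ} (Q : QuadraticForm K (Fin n → K)) where
  carrier : Type
  [acg : AddCommGroup carrier]
  [modK : Module K carrier]
  [modC : Module (CliffordAlgebra Q) carrier]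
  [tower : IsScalarTower K (CliffordAlgebra Q) carrier]
  g : ZMod 2 → Submodule K carrier
  sup_eq : g 0 ⊔ g 1 = ⊤
  inf_eq : g 0 ⊓ g 1 = ⊥
  smul_mem : ∀ (a b : ZMod 2), ∀ c ∈ CliffordAlgebra.evenOdd Q a, ∀ x ∈ g b,
    c • x ∈ g (a + b)

attribute [instance] GrMod.acg GrMod.modK GrMod.modC GrMod.tower

variable {n : ℕ} {Q : QuadraticForm K (Fin n → K)}

/-- A graded submodule: a `CliffordAlgebra Q`-submodule `N` with `N = (N ∩ M₀) ⊕ (N ∩ M₁)`. -/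
def GrMod.IsGradedSubmodule (M : GrMod Q) (N : Submodule (CliffordAlgebra Q) M.carrier) :
    Prop :=
  ∀ x ∈ N, ∃ x0 x1, x0 ∈ M.g 0 ∧ x1 ∈ M.g 1 ∧ x0 ∈ N ∧ x1 ∈ N ∧ x = x0 + x1

/-- A graded-simple graded module: nonzero, and its only graded submodules are `⊥` and `⊤`. -/
def GrMod.IsGradedSimple (M : GrMod Q) : Prop :=
  (∃ x : M.carrier, x ≠ 0) ∧
  ∀ N : Submodule (CliffordAlgebra Q) M.carrier, M.IsGradedSubmodule N → N = ⊥ ∨ N = ⊤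

/-- Isomorphism of graded modules: a `CliffordAlgebra Q`-linear equivalence matching
the gradings. -/
def GrMod.Iso (M M' : GrMod Q) : Prop :=
  ∃ e : M.carrier ≃ₗ[CliffordAlgebra Q] M'.carrier,
    ∀ a : ZMod 2, ∀ x : M.carrier, x ∈ M.g a ↔ e x ∈ M'.g a


/-! ### Split Clifford representations over a general field -/

/-- A vector space with `p` anticommuting involutions `T 0, …, T (p-1)`. -/
structure Rp (F : Type) [Field F] (p : ℕ) where
  carrier : Type
  [acg : AddCommGroup carrier]
  [md : Module F carrier]
  T : ℕ → carrier →ₗ[F] carrier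
  sq : ∀ i < p, ∀ x, T i (T i x) = x
  anti : ∀ i < p, ∀ j < p, i ≠ j → ∀ x, T i (T j x) = - T j (T i x)

attribute [instance] Rp.acg Rp.md

namespace Rp

variable {F : Type} [Field F] {p : ℕ}

/-- Simplicity of a representation. -/
def Simple (V : Rp F p) : Prop :=
  (∃ x : V.carrier, x ≠ 0) ∧
  ∀ N : Submodule F V.carrier, (∀ i < p, ∀ x ∈ N, V.T i x ∈ N) → N = ⊥ ∨ N = ⊤

/-- Isomorphism of representations. -/
def Iso (V W : Rp F p) : Prop :=
  ∃ e : V.carrier ≃ₗ[F] W.carrier, ∀ i < p, ∀ x, e (V.T i x) = W.T i (e x)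

lemma Iso.symm {V W : Rp F p} (h : V.Iso W) : W.Iso V := by
  obtain ⟨e, he⟩ := h
  refine ⟨e.symm, fun i hi x => ?_⟩
  apply e.injective
  simp [he i hi]

lemma Iso.trans {V W U : Rp F p} (h : V.Iso W) (h' : W.Iso U) : V.Iso U := by
  obtain ⟨e, he⟩ := h
  obtain ⟨e', he'⟩ := h'
  exact ⟨e.trans e', fun i hi x => by simp [he i hi, he' i hi]⟩

lemma Iso.finrank_eq {V W : Rp F p} (h : V.Iso W) :
    Module.finrank F V.carrier = Module.finrank F W.carrier := by
  obtain ⟨e, he⟩ := h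
  exact e.finrank_eq

lemma Iso.simple {V W : Rp F p} (h : V.Iso W) (hV : V.Simple) : W.Simple := by
  obtain ⟨e, he⟩ := h
  obtain ⟨⟨x, hx⟩, hs⟩ := hV
  refine ⟨⟨e x, by simpa using hx⟩, fun N hN => ?_⟩
  have key := hs (N.comap (e : V.carrier →ₗ[F] W.carrier)) (fun i hi x hx => by
    simp only [Submodule.mem_comap, LinearEquiv.coe_coe] at hx ⊢
    rw [he i hi]; exact hN i hi _ hx)
  have aux : ∀ y, y ∈ N ↔ e.symm y ∈ N.comap (e : V.carrier →ₗ[F] W.carrier) := by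
    intro y; simp
  rcases key with h | h
  · left
    rw [eq_bot_iff]
    intro y hy
    rw [aux, h] at hy
    simpa using hy
  · right
    rw [eq_top_iff]
    intro y _
    rw [aux, h]; trivial

/-- Doubling: from `p` to `p + 2` involutions. -/
abbrev dbl (I : F) (hI : I * I = -1) (V : Rp F p) : Rp F (p + 2) where
  carrier := V.carrier × V.carrier
  T i := if i < p then
      LinearMap.prod (V.T i ∘ₗ LinearMap.fst F _ _) (-(V.T i ∘ₗ LinearMap.snd F _ _))
    else if i = p then LinearMap.prod (LinearMap.snd F _ _) (LinearMap.fst F _ _)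
    else LinearMap.prod (I • LinearMap.snd F _ _) (-(I • LinearMap.fst F _ _))
  sq := by
    intro i hi x
    split_ifs with h1 h2
    · simp [V.sq i h1]
    · simp
    · simp [smul_smul, hI]
  anti := by
    intro i hi j hj hij x
    have := hij.symm
    by_cases h1 : i < p <;> by_cases h2 : j < p
    · ext <;> simp [h1, h2, V.anti i h1 j h2 hij]
    · by_cases h3 : j = p
      · ext <;> simp [h1, h3]
      · ext <;> simp [h1, h2, h3]
    · by_cases h3 : i = p
      · ext <;> simp [h2, h3]
      · ext <;> simp [h1, h2, h3]
    · by_cases h3 : i = p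
      · have h4 : j ≠ p := by omega
        ext <;> simp [h2, h3, h4]
      · have h4 : j = p := by omega
        ext <;> simp [h1, h3, h4]

section
variable (I : F) (hI : I * I = -1)

lemma dbl_T_lt (V : Rp F p) {i : ℕ} (hi : i < p) (x y : V.carrier) :
    (dbl I hI V).T i (x, y) = ((V.T i x, - V.T i y) : V.carrier × V.carrier) := by
  simp [dbl, hi]

lemma dbl_T_p (V : Rp F p) (x y : V.carrier) :
    (dbl I hI V).T p (x, y) = ((y, x) : V.carrier × V.carrier) := by
  simp [dbl]

lemma dbl_T_p1 (V : Rp F p) (x y : V.carrier) :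
    (dbl I hI V).T (p + 1) (x, y) = ((I • y, -(I • x)) : V.carrier × V.carrier) := by
  simp [dbl]

lemma simple_of_dbl (V : Rp F p) (h : (dbl I hI V).Simple) : V.Simple := by
  obtain ⟨⟨x, hx⟩, hs⟩ := h
  refine ⟨?_, fun N hN => ?_⟩
  · by_contra! hc
    exact hx (Prod.ext (hc x.1) (hc x.2))
  have key := hs (Submodule.prod N N) (by
    rintro i hi ⟨x, y⟩ hxy
    obtain ⟨h1, h2⟩ := Submodule.mem_prod.1 hxy
    by_cases h : i < p
    · rw [dbl_T_lt I hI V h]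
      exact Submodule.mem_prod.2 ⟨hN i h _ h1, N.neg_mem (hN i h _ h2)⟩
    · obtain rfl | rfl : i = p ∨ i = p + 1 := by omega
      · rw [dbl_T_p I hI V]
        exact Submodule.mem_prod.2 ⟨h2, h1⟩
      · rw [dbl_T_p1 I hI V]
        exact Submodule.mem_prod.2 ⟨N.smul_mem _ h2, N.neg_mem (N.smul_mem _ h1)⟩)
  rcases key with h | h
  · left
    rw [eq_bot_iff]
    intro y hy
    have : ((y, 0) : V.carrier × V.carrier) ∈ Submodule.prod N N :=
      Submodule.mem_prod.2 ⟨hy, N.zero_mem⟩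
    erw [h] at this
    have := congrArg Prod.fst ((Submodule.mem_bot F).1 this)
    exact (Submodule.mem_bot F).2 this
  · right
    rw [eq_top_iff]
    intro y _
    have : ((y, 0) : V.carrier × V.carrier) ∈ Submodule.prod N N := by
      erw [h]; trivial
    exact (Submodule.mem_prod.1 this).1

lemma dbl_simple (h2 : (2 : F) ≠ 0) (V : Rp F p) (h : V.Simple) : (dbl I hI V).Simple := by
  obtain ⟨⟨x, hx⟩, hs⟩ := h
  refine ⟨⟨((x, 0) : V.carrier × V.carrier), fun h => hx (congrArg Prod.fst h)⟩, fun N hN => ?_⟩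
  change Submodule F (V.carrier × V.carrier) at N
  have ha : ∀ x y : V.carrier, (x, y) ∈ N → (y, x) ∈ N := by
    intro x y hxy
    have := hN p (by omega) _ hxy
    rwa [dbl_T_p I hI V] at this
  have hb : ∀ x y : V.carrier, (x, y) ∈ N → (I • y, -(I • x)) ∈ N := by
    intro x y hxy
    have := hN (p + 1) (by omega) _ hxy
    rwa [dbl_T_p1 I hI V] at this
  have hh : ∀ x y : V.carrier, (x, y) ∈ N → (x, -y) ∈ N := by
    intro x y hxy
    have := N.smul_mem I (ha _ _ (hb _ _ hxy))
    simpa [smul_smul, hI] using this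
  have h1 : ∀ x y : V.carrier, (x, y) ∈ N → (x, 0) ∈ N := by
    intro x y hxy
    have := N.smul_mem (2 : F)⁻¹ (N.add_mem hxy (hh _ _ hxy))
    simpa [← two_smul F x, smul_smul, h2] using this
  have key := hs (N.comap (LinearMap.inl F V.carrier V.carrier)) (by
    intro i hi x hx
    have := hN i (by omega) _ hx
    simp only [LinearMap.inl_apply] at this
    rw [dbl_T_lt I hI V hi] at this
    simpa using this)
  rcases key with h | h
  · left
    rw [eq_bot_iff]
    rintro ⟨x, y⟩ hxy
    have hx : x ∈ N.comap (LinearMap.inl F V.carrier V.carrier) := h1 _ _ hxy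
    have hy : y ∈ N.comap (LinearMap.inl F V.carrier V.carrier) := h1 _ _ (ha _ _ hxy)
    rw [h, Submodule.mem_bot] at hx hy
    subst hx hy
    exact Submodule.zero_mem _
  · right
    rw [eq_top_iff]
    rintro ⟨x, y⟩ -
    have hx : x ∈ N.comap (LinearMap.inl F V.carrier V.carrier) := by rw [h]; trivial
    have hy : y ∈ N.comap (LinearMap.inl F V.carrier V.carrier) := by rw [h]; trivial
    have := N.add_mem hx (ha _ _ hy)
    simpa using this

lemma dbl_iso {V W : Rp F p} (h : V.Iso W) : (dbl I hI V).Iso (dbl I hI W) := by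
  obtain ⟨e, he⟩ := h
  refine ⟨(LinearEquiv.prodCongr e e : (V.carrier × V.carrier) ≃ₗ[F] (W.carrier × W.carrier)), ?_⟩
  rintro i hi ⟨x, y⟩
  by_cases h : i < p
  · rw [dbl_T_lt I hI V h]
    simp only [LinearEquiv.prodCongr_apply]
    rw [dbl_T_lt I hI W h]
    simp [he i h]
  · obtain rfl | rfl : i = p ∨ i = p + 1 := by omega
    · rw [dbl_T_p I hI V]
      change ((e y, e x) : W.carrier × W.carrier) = (dbl I hI W).T i (e x, e y)
      rw [dbl_T_p I hI W]
    · rw [dbl_T_p1 I hI V]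
      simp only [LinearEquiv.prodCongr_apply]
      rw [dbl_T_p1 I hI W]
      simp

lemma iso_of_dbl (h2 : (2 : F) ≠ 0) {V W : Rp F p} (h : (dbl I hI V).Iso (dbl I hI W)) :
    V.Iso W := by
  obtain ⟨e, he⟩ := h
  change (V.carrier × V.carrier) ≃ₗ[F] (W.carrier × W.carrier) at e
  -- second component of `e (x, 0)` vanishes
  have key : ∀ {V W : Rp F p} (e : (V.carrier × V.carrier) ≃ₗ[F] (W.carrier × W.carrier)),
      (∀ i < p + 2, ∀ x : V.carrier × V.carrier,
        e ((dbl I hI V).T i x) = (dbl I hI W).T i (e x)) →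
      ∀ x, (e (x, 0)).2 = 0 := by
    intro V W e he x
    have h3 := he p (by omega) (x, 0)
    rw [dbl_T_p I hI V] at h3
    have h4 := he (p + 1) (by omega) (x, 0)
    rw [dbl_T_p1 I hI V] at h4
    generalize hz : e (x, 0) = z at h3 h4
    obtain ⟨u, v⟩ := z
    rw [dbl_T_p I hI W] at h3
    rw [dbl_T_p1 I hI W] at h4
    have h5 : ((I • (0 : V.carrier), -(I • x)) : V.carrier × V.carrier)
      = -(I • ((0, x) : V.carrier × V.carrier)) := by simp
    rw [h5, map_neg, map_smul, h3] at h4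
    have h6 := congrArg Prod.fst h4
    simp only [Prod.smul_mk, Prod.neg_mk] at h6
    have h7 : (2 * I) • v = 0 := by
      rw [two_mul, add_smul]
      nth_rewrite 1 [← h6]
      simp
    have hI0 : I ≠ 0 := by
      rintro rfl
      simp at hI
    simpa [h2, hI0] using h7
  have he' : ∀ i < p + 2, ∀ x : W.carrier × W.carrier,
      e.symm ((dbl I hI W).T i x) = (dbl I hI V).T i (e.symm x) := by
    intro i hi x
    apply e.injective
    have := he i hi (e.symm x)
    rw [e.apply_symm_apply] at this ⊢
    exact this.symm
  have k1 := key e he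
  have k2 := key e.symm he'
  have l1 : ∀ x, ((e (x, 0)).1, (0 : W.carrier)) = e (x, 0) := fun x =>
    Prod.ext rfl (k1 x).symm
  have l2 : ∀ x, ((e.symm (x, 0)).1, (0 : V.carrier)) = e.symm (x, 0) := fun x =>
    Prod.ext rfl (k2 x).symm
  refine ⟨LinearEquiv.ofLinearMap
    (LinearMap.fst F _ _ ∘ₗ e.toLinearMap ∘ₗ LinearMap.inl F V.carrier V.carrier)
    (LinearMap.fst F _ _ ∘ₗ e.symm.toLinearMap ∘ₗ LinearMap.inl F W.carrier W.carrier)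
    ?_ ?_, ?_⟩
  · ext x
    simp [l2]
  · ext x
    simp [l1]
  · intro i hi x
    change (e (V.T i x, 0)).1 = W.T i (e (x, 0)).1
    have h3 := he i (by omega) (x, 0)
    rw [dbl_T_lt I hI V hi, map_zero, neg_zero] at h3
    rw [h3, ← l1 x, dbl_T_lt I hI W hi]

lemma exists_dbl (h2 : (2 : F) ≠ 0) (M : Rp F (p + 2)) : ∃ V : Rp F p, (dbl I hI V).Iso M := by
  let P : Submodule F M.carrier :=
    LinearMap.ker (I • (M.T p ∘ₗ M.T (p + 1)) - LinearMap.id)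
  have hP : ∀ x, x ∈ P ↔ I • M.T p (M.T (p + 1) x) = x := by
    intro x
    simp [P, sub_eq_zero]
  have hinv : ∀ i < p, ∀ x ∈ P, M.T i x ∈ P := by
    intro i hi x hx
    rw [hP] at hx ⊢
    rw [M.anti (p + 1) (by omega) i (by omega) (by omega), map_neg,
      M.anti p (by omega) i (by omega) (by omega), neg_neg, ← map_smul, hx]
  let V : Rp F p :=
    { carrier := P
      T := fun i => if h : i < p then (M.T i).restrict (hinv i h) else 0
      sq := by
        intro i hi x
        apply Subtype.ext
        simp [hi, M.sq i (by omega : i < p + 2)]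
      anti := by
        intro i hi j hj hij x
        apply Subtype.ext
        simp [hi, hj, M.anti i (by omega) j (by omega) hij] }
  have hVT : ∀ i < p, ∀ x : P, ((V.T i x : P) : M.carrier) = M.T i x := by
    intro i hi x
    simp [V, hi]
  refine ⟨V, ?_⟩
  let φ : (P × P) →ₗ[F] M.carrier :=
    P.subtype ∘ₗ LinearMap.fst F P P + M.T p ∘ₗ P.subtype ∘ₗ LinearMap.snd F P P
  have hφ : ∀ x y : P, φ (x, y) = (x : M.carrier) + M.T p y := fun x y => by simp [φ]
  -- `b x = -I a x` on `P`
  have hb : ∀ x : P, M.T (p + 1) x = -(I • M.T p x) := by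
    intro x
    have h := (hP _).1 x.2
    have h3 := congrArg (M.T p) h
    rw [map_smul, M.sq p (by omega)] at h3
    rw [← h3, smul_smul, hI]
    simp
  have hab : ∀ x : P, I • M.T p (M.T (p + 1) (M.T p x)) = - M.T p x := by
    intro x
    rw [M.anti (p + 1) (by omega) p (by omega) (by omega), hb]
    simp [M.sq p (by omega : p < p + 2), smul_smul, hI]
  have hbij : Function.Bijective φ := by
    constructor
    · rw [injective_iff_map_eq_zero]
      rintro ⟨x, y⟩ h
      rw [hφ] at h
      have h3 := congrArg (fun z => I • M.T p (M.T (p + 1) z)) h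
      simp only [map_add, smul_add, hab, (hP _).1 x.2, map_zero, smul_zero] at h3
      have h4 : (2 : F) • (x : M.carrier) = 0 := by
        have := congrArg₂ (· + ·) h h3
        simp only [add_zero] at this
        rw [two_smul, ← this]; abel
      have hx : (x : M.carrier) = 0 := by simpa [h2] using h4
      have hy : (y : M.carrier) = 0 := by
        rw [hx, zero_add] at h
        rw [← M.sq p (by omega) (y : M.carrier), h, map_zero]
      exact Prod.ext (Subtype.ext hx) (Subtype.ext hy)
    · intro z
      have hhh : ∀ z, I • M.T p (M.T (p + 1) (I • M.T p (M.T (p + 1) z))) = z := by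
        intro z
        rw [map_smul, map_smul, smul_smul, hI, M.anti (p + 1) (by omega) p (by omega) (by omega),
          map_neg, M.sq p (by omega), M.sq (p + 1) (by omega)]
        simp
      have m1 : ∀ z, (2 : F)⁻¹ • (z + I • M.T p (M.T (p + 1) z)) ∈ P := by
        intro z
        rw [hP, map_smul, map_smul, smul_comm, map_add, map_add, smul_add, hhh, add_comm z]
      have m2 : M.T p ((2 : F)⁻¹ • (z - I • M.T p (M.T (p + 1) z))) ∈ P := by
        have := m1 (M.T p z)
        convert this using 1
        rw [map_smul, map_sub, map_smul, M.anti (p + 1) (by omega) p (by omega) (by omega),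
          map_neg, smul_neg, sub_eq_add_neg]
      refine ⟨(⟨_, m1 z⟩, ⟨_, m2⟩), ?_⟩
      rw [hφ]
      simp only
      rw [M.sq p (by omega), ← smul_add]
      have : (z + I • M.T p (M.T (p + 1) z)) + (z - I • M.T p (M.T (p + 1) z)) = (2 : F) • z := by
        rw [two_smul]; abel
      rw [this, smul_smul, inv_mul_cancel₀ h2, one_smul]
  refine ⟨LinearEquiv.ofBijective φ hbij, ?_⟩
  rintro i hi ⟨x, y⟩
  simp only [LinearEquiv.ofBijective_apply]
  by_cases h : i < p
  · rw [dbl_T_lt I hI V h]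
    erw [hφ, hφ]
    rw [NegMemClass.coe_neg, hVT i h, hVT i h, map_add, M.anti i (by omega) p (by omega) (by omega),
      map_neg]
  · obtain rfl | rfl : i = p ∨ i = p + 1 := by omega
    · rw [dbl_T_p I hI V]
      erw [hφ, hφ]
      rw [map_add, M.sq i (by omega)]
      exact add_comm _ _
    · rw [dbl_T_p1 I hI V]
      erw [hφ, hφ]
      rw [map_add, M.anti (p + 1) (by omega) p (by omega) (by omega), hb, hb]
      change I • (y : M.carrier) + M.T p (-(I • (x : M.carrier))) = _
      simp [M.sq p (by omega : p < p + 2), add_comm]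

end

/-- One-dimensional representations for `p ≤ 1`. -/
abbrev line (hp : p ≤ 1) (c : F) (hc : c * c = 1) : Rp F p where
  carrier := F
  T _ := c • LinearMap.id
  sq := by
    intro i hi x
    simp [← mul_assoc, hc]
  anti := by
    intro i hi j hj hij
    omega

lemma line_simple (hp : p ≤ 1) (c : F) (hc : c * c = 1) : (line hp c hc).Simple := by
  refine ⟨⟨(1 : F), one_ne_zero⟩, fun N _ => ?_⟩
  exact eq_bot_or_eq_top (α := Submodule F F) N

lemma line_iso (hp : p ≤ 1) (c : F) (hc : c * c = 1) (V : Rp F p) (hV : V.Simple)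
    (x : V.carrier) (hx : x ≠ 0) (h : ∀ i < p, V.T i x = c • x) : V.Iso (line hp c hc) := by
  apply Iso.symm
  have htop : F ∙ x = ⊤ := by
    rcases hV.2 (F ∙ x) (by
      intro i hi y hy
      obtain ⟨a, rfl⟩ := Submodule.mem_span_singleton.1 hy
      rw [map_smul, h i hi, smul_smul]
      exact Submodule.mem_span_singleton.2 ⟨_, rfl⟩) with h | h
    · exact absurd (Submodule.span_singleton_eq_bot.1 h) hx
    · exact h
  refine ⟨(LinearEquiv.ofBijective (LinearMap.toSpanSingleton F V.carrier x) ?_ :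
    F ≃ₗ[F] V.carrier), ?_⟩
  · constructor
    · rw [injective_iff_map_eq_zero]
      intro a ha
      simpa [hx] using ha
    · intro y
      have : y ∈ F ∙ x := by rw [htop]; trivial
      obtain ⟨a, ha⟩ := Submodule.mem_span_singleton.1 this
      exact ⟨a, by simpa using ha⟩
  · intro i hi a
    change (c * a) • x = V.T i (a • x)
    rw [map_smul, h i hi, smul_smul, mul_comm]

lemma classify_even (I : F) (hI : I * I = -1) (h2 : (2 : F) ≠ 0) (k : ℕ) :
    ∃ S : Rp F (2 * k), S.Simple ∧ Module.Finite F S.carrier ∧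
      Module.finrank F S.carrier = 2 ^ k ∧ ∀ V : Rp F (2 * k), V.Simple → V.Iso S := by
  induction k with
  | zero =>
    refine ⟨line (by omega) 1 (by simp), line_simple _ _ _, ?_, ?_, ?_⟩
    · exact (inferInstance : Module.Finite F F)
    · exact Module.finrank_self F
    · intro V hV
      obtain ⟨x, hx⟩ := hV.1
      exact line_iso _ _ _ V hV x hx (by intro i hi; omega)
  | succ k ih =>
    obtain ⟨S, hS, hf, hd, hu⟩ := ih
    refine ⟨dbl I hI S, dbl_simple I hI h2 S hS, ?_, ?_, ?_⟩
    · exact (inferInstance : Module.Finite F (S.carrier × S.carrier))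
    · refine (Module.finrank_prod (R := F) (M := S.carrier) (M' := S.carrier)).trans ?_
      rw [hd]; ring
    · intro V hV
      obtain ⟨W, hW⟩ := exists_dbl I hI h2 V
      exact hW.symm.trans (dbl_iso I hI (hu W (simple_of_dbl I hI W (hW.symm.simple hV))))

lemma classify_odd (I : F) (hI : I * I = -1) (h2 : (2 : F) ≠ 0) (k : ℕ) :
    ∃ S S' : Rp F (2 * k + 1), S.Simple ∧ S'.Simple ∧
      Module.Finite F S.carrier ∧ Module.Finite F S'.carrier ∧
      Module.finrank F S.carrier = 2 ^ k ∧ Module.finrank F S'.carrier = 2 ^ k ∧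
      ¬ S.Iso S' ∧
      ∀ V : Rp F (2 * k + 1), V.Simple → V.Iso S ∨ V.Iso S' := by
  induction k with
  | zero =>
    refine ⟨line (by omega) 1 (by simp), line (by omega) (-1) (by simp), line_simple _ _ _,
      line_simple _ _ _, (inferInstance : Module.Finite F F), (inferInstance : Module.Finite F F),
      Module.finrank_self F, Module.finrank_self F, ?_, ?_⟩
    · rintro ⟨e, he⟩
      change F ≃ₗ[F] F at e
      have h := he 0 (by omega) (1 : F)
      change e ((1 : F) * 1) = (-1 : F) * e 1 at h
      have h3 : (2 : F) * e 1 = 0 := by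
        rw [mul_one] at h
        linear_combination h
      simp [h2] at h3
    · intro V hV
      obtain ⟨x, hx⟩ := hV.1
      by_cases h : x + V.T 0 x = 0
      · right
        refine line_iso _ _ _ V hV x hx ?_
        intro i hi
        obtain rfl : i = 0 := by omega
        rw [neg_smul, one_smul]
        exact (neg_eq_of_add_eq_zero_right h).symm
      · left
        refine line_iso _ _ _ V hV _ h ?_
        intro i hi
        obtain rfl : i = 0 := by omega
        rw [map_add, V.sq 0 (by omega), one_smul, add_comm x]
  | succ k ih =>
    obtain ⟨S, S', hS, hS', hf, hf', hd, hd', hn, hu⟩ := ih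
    refine ⟨dbl I hI S, dbl I hI S', dbl_simple I hI h2 S hS, dbl_simple I hI h2 S' hS',
      (inferInstance : Module.Finite F (S.carrier × S.carrier)),
      (inferInstance : Module.Finite F (S'.carrier × S'.carrier)), ?_, ?_, ?_, ?_⟩
    · refine (Module.finrank_prod (R := F) (M := S.carrier) (M' := S.carrier)).trans ?_
      rw [hd]; ring
    · refine (Module.finrank_prod (R := F) (M := S'.carrier) (M' := S'.carrier)).trans ?_
      rw [hd']; ring
    · exact fun h => hn (iso_of_dbl I hI h2 h)
    · intro V hV
      obtain ⟨W, hW⟩ := exists_dbl I hI h2 V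
      rcases hu W (simple_of_dbl I hI W (hW.symm.simple hV)) with h | h
      · exact Or.inl (hW.symm.trans (dbl_iso I hI h))
      · exact Or.inr (hW.symm.trans (dbl_iso I hI h))

end Rp

/-! ### Square roots of the coefficients -/

lemma sqrt_one_sub_pow (k : ℕ) (hk : k ≠ 0) : ∃ f : K, f * f = 1 - qq ^ k := by
  have ha : PowerSeries.HasSubst (-(PowerSeries.X ^ k) : PowerSeries ℂ) := by
    apply PowerSeries.HasSubst.of_constantCoeff_zero'
    simp [hk]
  have h1 : (PowerSeries.binomialSeries ℂ (1 / 2 : ℚ)) * (PowerSeries.binomialSeries ℂ (1 / 2 : ℚ))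
      = 1 + PowerSeries.X := by
    rw [← PowerSeries.binomialSeries_add]
    have : (1 / 2 + 1 / 2 : ℚ) = ((1 : ℕ) : ℚ) := by norm_num
    rw [this, PowerSeries.binomialSeries_nat, pow_one]
  have h2 := congrArg (PowerSeries.substAlgHom (R := ℂ) ha) h1
  rw [map_mul, map_add, map_one, PowerSeries.substAlgHom_X] at h2
  have h3 := congrArg (HahnSeries.ofPowerSeries ℤ ℂ) h2
  rw [map_mul] at h3
  refine ⟨_, h3.trans ?_⟩
  rw [map_add, map_one, map_neg, map_pow, HahnSeries.ofPowerSeries_X, sub_eq_add_neg]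
  rfl

lemma qq_ne : qq ≠ 0 := by
  unfold qq
  simp

lemma qq_pow_ne (k : ℕ) (hk : k ≠ 0) : (1 : K) - qq ^ k ≠ 0 := by
  intro h
  have h1 := congrArg (fun f : K => f.coeff 0) h
  have : qq ^ k = HahnSeries.single (k : ℤ) (1 : ℂ) := by
    unfold qq
    simp [HahnSeries.single_pow]
  rw [this] at h1
  have hk' : (0 : ℤ) ≠ (k : ℤ) := by exact_mod_cast Ne.symm hk
  simp [HahnSeries.coeff_single, hk'] at h1

lemma exists_I : ∃ I : K, I * I = -1 := by
  refine ⟨HahnSeries.C Complex.I, ?_⟩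
  rw [← map_mul, Complex.I_mul_I, map_neg, map_one]

lemma cw_zero : cw 0 = 0 := by simp [cw]

lemma field_aux1 {F : Type} [Field F] (a b c : F) : (a - b) / c = -((b - a) / c) := by ring

lemma field_aux2 {F : Type} [Field F] (a b c d : F) (ha : a ≠ 0) :
    -(a * (b * c)) / -(a * d) = b * (c / d) := by
  rw [neg_div_neg_eq, mul_div_mul_left _ _ ha, mul_div_assoc]

lemma cw_neg (l : ℤ) : cw (-l) = - cw l := by
  have h1 : 2 * -l = -(2 * l) := by ring
  simp only [cw]
  rw [h1, neg_neg]
  exact field_aux1 _ _ _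

lemma cw_nat (l : ℕ) (hl : l ≠ 0) :
    cw l = (qq ^ (1 - (l : ℤ)) * qq ^ (1 - (l : ℤ))) * ((1 - qq ^ (4 * l)) / (1 - qq ^ 4)) := by
  have h4 := qq_pow_ne 4 (by norm_num)
  have hq := qq_ne
  have e1 : qq ^ (2 : ℤ) - qq ^ (-2 : ℤ) = -(qq ^ (-2 : ℤ) * (1 - qq ^ 4)) := by
    have : qq ^ (2 : ℤ) = qq ^ (-2 : ℤ) * qq ^ 4 := by
      rw [← zpow_natCast, ← zpow_add₀ hq]; norm_num
    rw [this]; ring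
  have e2 : qq ^ (2 * (l : ℤ)) - qq ^ (-(2 * (l : ℤ))) =
      -(qq ^ (-2 : ℤ) * (qq ^ (1 - (l : ℤ)) * qq ^ (1 - (l : ℤ)) * (1 - qq ^ (4 * l)))) := by
    have h1 : qq ^ (-(2 * (l : ℤ))) = qq ^ (-2 : ℤ) * (qq ^ (1 - (l : ℤ)) * qq ^ (1 - (l : ℤ))) := by
      rw [← zpow_add₀ hq, ← zpow_add₀ hq]; congr 1; ring
    have h2 : qq ^ (2 * (l : ℤ)) = qq ^ (-(2 * (l : ℤ))) * qq ^ (4 * l) := by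
      rw [← zpow_natCast, ← zpow_add₀ hq]; congr 1; push_cast; ring
    rw [h2, h1]; ring
  have h2 : qq ^ (-2 : ℤ) ≠ 0 := zpow_ne_zero _ hq
  unfold cw
  rw [e1, e2]
  exact field_aux2 _ _ _ _ h2

lemma cw_nat_sq (l : ℕ) (hl : l ≠ 0) : ∃ s : K, s * s = cw l ∧ s ≠ 0 := by
  obtain ⟨f, hf⟩ := sqrt_one_sub_pow (4 * l) (by omega)
  obtain ⟨g, hg⟩ := sqrt_one_sub_pow 4 (by omega)
  have h1 := qq_pow_ne (4 * l) (by omega)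
  have h2 := qq_pow_ne 4 (by omega)
  refine ⟨qq ^ (1 - (l : ℤ)) * (f / g), ?_, ?_⟩
  · rw [cw_nat l hl, ← hf, ← hg]
    ring
  · refine mul_ne_zero (zpow_ne_zero _ qq_ne) (div_ne_zero ?_ ?_)
    · rintro rfl; exact h1 (by rw [← hf]; simp)
    · rintro rfl; exact h2 (by rw [← hg]; simp)

lemma cw_sq (l : ℤ) : ∃ s : K, s * s = cw l ∧ (s = 0 ↔ l = 0) := by
  obtain ⟨I, hI⟩ := exists_I
  have hI0 : I ≠ 0 := by
    rintro rfl
    simp at hI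
  obtain ⟨k, rfl | rfl⟩ := l.eq_nat_or_neg
  · by_cases hk : k = 0
    · subst hk; exact ⟨0, by simp [cw_zero], by simp⟩
    · obtain ⟨s, hs, h0⟩ := cw_nat_sq k hk
      exact ⟨s, hs, by simp [h0, hk]⟩
  · by_cases hk : k = 0
    · subst hk; exact ⟨0, by simp [cw_zero], by simp⟩
    · obtain ⟨s, hs, h0⟩ := cw_nat_sq k hk
      refine ⟨I * s, ?_, by simp [h0, hk, hI0]⟩
      rw [cw_neg, ← hs]
      linear_combination (s * s) * hI

/-! ### Translation between graded modules and split Clifford representations -/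

lemma K_two_ne : (2 : K) ≠ 0 := by
  intro h
  have h1 : (HahnSeries.C (2 : ℂ) : K) = 0 := by
    rw [map_ofNat]; exact h
  simp at h1

lemma K_zero_smul {V : Type} [AddCommGroup V] [Module K V] (x : V) : (0 : K) • x = 0 :=
  zero_smul K x

lemma smul_algebraMap_aux {F A : Type} [Field F] [Ring A] [Algebra F A] (a b : F) :
    a • algebraMap F A b = algebraMap F A (b * a) := by
  rw [Algebra.smul_def, ← map_mul, mul_comm]

/-- The generators `t_j`. -/
def tg {n : ℕ} (lam : Fin n → ℤ) (j : Fin n) : CliffordAlgebra (Qform n lam) :=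
  CliffordAlgebra.ι (Qform n lam) (Pi.single j 1)

section
variable {n : ℕ} {lam : Fin n → ℤ}

lemma Qform_apply (v : Fin n → K) : Qform n lam v = ∑ i, cw (lam i) * (v i * v i) := by
  simp [Qform, QuadraticMap.weightedSumSquares_apply]

lemma tg_sq (j : Fin n) : tg lam j * tg lam j = algebraMap K _ (cw (lam j)) := by
  rw [tg, CliffordAlgebra.ι_sq_scalar, Qform_apply]
  congr 1
  rw [Finset.sum_eq_single j]
  · simp
  · intro b _ hb
    simp [Pi.single_eq_of_ne hb]
  · simp

lemma tg_anti {j k : Fin n} (h : j ≠ k) : tg lam j * tg lam k = -(tg lam k * tg lam j) := by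
  refine CliffordAlgebra.ι_mul_ι_comm_of_isOrtho ?_
  rw [QuadraticMap.isOrtho_def, Qform_apply, Qform_apply, Qform_apply, ← Finset.sum_add_distrib]
  refine Finset.sum_congr rfl fun i _ => ?_
  by_cases h1 : i = j
  · have h2 : i ≠ k := by rw [h1]; exact h
    simp [Pi.single_eq_of_ne h2]
  · simp [Pi.single_eq_of_ne h1]

lemma iota_expand (v : Fin n → K) :
    CliffordAlgebra.ι (Qform n lam) v = ∑ j, v j • tg lam j := by
  conv_lhs => rw [← Finset.univ_sum_single v]
  rw [map_sum]
  refine Finset.sum_congr rfl fun j _ => ?_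
  rw [tg, ← map_smul]
  congr 1
  funext i
  by_cases h : i = j
  · subst h
    simp
  · simp [Pi.single_eq_of_ne h]

/-- A `K`-subspace stable under all generators is stable under the Clifford algebra. -/
lemma smul_mem_of (M : GrMod (Qform n lam)) (N : Submodule K M.carrier)
    (h : ∀ j, ∀ x ∈ N, tg lam j • x ∈ N) (c : CliffordAlgebra (Qform n lam)) :
    ∀ x ∈ N, c • x ∈ N := by
  induction c using CliffordAlgebra.induction with
  | algebraMap r =>
    intro x hx
    rw [algebraMap_smul]
    exact N.smul_mem _ hx
  | ι v =>
    intro x hx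
    rw [iota_expand, Finset.sum_smul]
    refine N.sum_mem fun j _ => ?_
    rw [smul_assoc]
    exact N.smul_mem _ (h j x hx)
  | mul a b ha hb =>
    intro x hx
    rw [mul_smul]
    exact ha _ (hb _ hx)
  | add a b ha hb =>
    intro x hx
    rw [add_smul]
    exact N.add_mem (ha _ hx) (hb _ hx)

/-- The Clifford submodule on a stable `K`-subspace. -/
def mkSub (M : GrMod (Qform n lam)) (N : Submodule K M.carrier)
    (h : ∀ j, ∀ x ∈ N, tg lam j • x ∈ N) :
    Submodule (CliffordAlgebra (Qform n lam)) M.carrier where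
  carrier := N
  add_mem' := N.add_mem
  zero_mem' := N.zero_mem
  smul_mem' c x hx := smul_mem_of M N h c x hx

lemma mem_mkSub (M : GrMod (Qform n lam)) (N : Submodule K M.carrier)
    (h : ∀ j, ∀ x ∈ N, tg lam j • x ∈ N) (x : M.carrier) : x ∈ mkSub M N h ↔ x ∈ N := Iff.rfl

lemma mkSub_cases (M : GrMod (Qform n lam)) (hM : M.IsGradedSimple) (N : Submodule K M.carrier)
    (h : ∀ j, ∀ x ∈ N, tg lam j • x ∈ N)
    (hg : ∀ x ∈ N, ∃ x0 x1, x0 ∈ M.g 0 ∧ x1 ∈ M.g 1 ∧ x0 ∈ N ∧ x1 ∈ N ∧ x = x0 + x1) :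
    N = ⊥ ∨ N = ⊤ := by
  rcases hM.2 (mkSub M N h) hg with h1 | h1
  · left
    rw [eq_bot_iff]
    intro x hx
    rw [← mem_mkSub M N h, h1] at hx
    simpa using hx
  · right
    rw [eq_top_iff]
    intro x _
    rw [← mem_mkSub M N h, h1]; trivial

lemma decomp (M : GrMod (Qform n lam)) (x : M.carrier) :
    ∃ x0 ∈ M.g 0, ∃ x1 ∈ M.g 1, x = x0 + x1 := by
  have : x ∈ M.g 0 ⊔ M.g 1 := by rw [M.sup_eq]; trivial
  obtain ⟨a, ha, b, hb, h⟩ := Submodule.mem_sup.1 this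
  exact ⟨a, ha, b, hb, h.symm⟩

lemma decomp_zero (M : GrMod (Qform n lam)) {x0 x1 : M.carrier} (h0 : x0 ∈ M.g 0)
    (h1 : x1 ∈ M.g 1) (h : x0 + x1 = 0) : x0 = 0 ∧ x1 = 0 := by
  have e : x0 = -x1 := eq_neg_of_add_eq_zero_left h
  have : x0 ∈ M.g 0 ⊓ M.g 1 := ⟨h0, by rw [e]; exact (M.g 1).neg_mem h1⟩
  rw [M.inf_eq, Submodule.mem_bot] at this
  refine ⟨this, ?_⟩
  rwa [this, zero_add] at h

lemma tg_mem0 (M : GrMod (Qform n lam)) (j : Fin n) {x : M.carrier} (h : x ∈ M.g 0) :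
    tg lam j • x ∈ M.g 1 := by
  have := M.smul_mem 1 0 _ (CliffordAlgebra.ι_mem_evenOdd_one _ (Pi.single j 1)) x h
  rw [add_zero] at this
  exact this

lemma tg_mem1 (M : GrMod (Qform n lam)) (j : Fin n) {x : M.carrier} (h : x ∈ M.g 1) :
    tg lam j • x ∈ M.g 0 :=
  M.smul_mem 1 1 _ (CliffordAlgebra.ι_mem_evenOdd_one _ (Pi.single j 1)) x h

lemma tg_smul_sq (M : GrMod (Qform n lam)) (j : Fin n) (x : M.carrier) :
    tg lam j • tg lam j • x = cw (lam j) • x := by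
  rw [smul_smul, tg_sq, algebraMap_smul]

lemma tg_smul_anti (M : GrMod (Qform n lam)) {j k : Fin n} (h : j ≠ k) (x : M.carrier) :
    tg lam j • tg lam k • x = -(tg lam k • tg lam j • x) := by
  rw [smul_smul, tg_anti h, neg_smul, smul_smul]

/-- Radical generators act by zero on graded-simple modules. -/
lemma kill (M : GrMod (Qform n lam)) (hM : M.IsGradedSimple) {j : Fin n} (hj : lam j = 0)
    (x : M.carrier) : tg lam j • x = 0 := by
  let N : Submodule K M.carrier := LinearMap.ker (Algebra.lsmul K K M.carrier (tg lam j))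
  have hN : ∀ x, x ∈ N ↔ tg lam j • x = 0 := by
    intro x
    simp [N]
  have hsq : ∀ x : M.carrier, tg lam j • tg lam j • x = 0 := by
    intro x
    rw [tg_smul_sq, hj, cw_zero, K_zero_smul]
  have key := mkSub_cases M hM N (by
    intro k x hx
    rw [hN] at hx ⊢
    by_cases h : j = k
    · subst h; exact hsq x
    · rw [tg_smul_anti M h, hx, smul_zero, neg_zero]) (by
    intro x hx
    obtain ⟨x0, h0, x1, h1, rfl⟩ := decomp M x
    rw [hN, smul_add, add_comm] at hx
    obtain ⟨e1, e0⟩ := decomp_zero M (tg_mem1 M j h1) (tg_mem0 M j h0) hx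
    exact ⟨x0, x1, h0, h1, (hN _).2 e0, (hN _).2 e1, rfl⟩)
  rcases key with h | h
  · have : tg lam j • x ∈ N := (hN _).2 (hsq x)
    rw [h] at this
    simpa using this
  · rw [← hN, h]; trivial

lemma exists_parity (M : GrMod (Qform n lam)) :
    ∃ ε : M.carrier →ₗ[K] M.carrier, (∀ x ∈ M.g 0, ε x = x) ∧ (∀ x ∈ M.g 1, ε x = -x) := by
  have hc : IsCompl (M.g 0) (M.g 1) :=
    ⟨disjoint_iff.2 M.inf_eq, codisjoint_iff.2 M.sup_eq⟩
  refine ⟨LinearMap.ofIsCompl hc (M.g 0).subtype (-(M.g 1).subtype), ?_, ?_⟩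
  · intro x hx
    exact LinearMap.ofIsCompl_apply_left hc ⟨x, hx⟩
  · intro x hx
    exact LinearMap.ofIsCompl_apply_right hc ⟨x, hx⟩

end

/-- Bookkeeping data: an enumeration of the nonzero entries and square roots. -/
structure Dat {n : ℕ} (lam : Fin n → ℤ) (m : ℕ) where
  f : ℕ → Fin n
  g : Fin n → ℕ
  s : Fin n → K
  s_sq : ∀ j, s j * s j = cw (lam j)
  s_zero : ∀ j, s j = 0 ↔ lam j = 0
  f_ne : ∀ i < m, lam (f i) ≠ 0
  gf : ∀ i < m, g (f i) = i
  g_lt : ∀ j, lam j ≠ 0 → g j < m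
  fg : ∀ j, lam j ≠ 0 → f (g j) = j

lemma exists_dat {n : ℕ} (lam : Fin n → ℤ) (m : ℕ)
    (hm : m = (Finset.univ.filter (fun i => lam i ≠ 0)).card) (hm1 : 1 ≤ m) :
    Nonempty (Dat lam m) := by
  choose s hs hs0 using cw_sq
  let e := (Finset.univ.filter (fun i => lam i ≠ 0)).equivFinOfCardEq hm.symm
  have hmem : ∀ j, lam j ≠ 0 → j ∈ Finset.univ.filter (fun i => lam i ≠ 0) := by
    intro j hj; simpa using hj
  refine ⟨⟨fun i => if h : i < m then (e.symm ⟨i, h⟩ : Fin n) else (e.symm ⟨0, hm1⟩ : Fin n),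
    fun j => if h : lam j ≠ 0 then (e ⟨j, hmem j h⟩ : ℕ) else 0, fun j => s (lam j),
    fun j => hs _, fun j => hs0 _, ?_, ?_, ?_, ?_⟩⟩
  · intro i hi
    simp only [hi, dif_pos]
    exact (Finset.mem_filter.1 (e.symm ⟨i, hi⟩).2).2
  · intro i hi
    have h1 : lam (e.symm ⟨i, hi⟩ : Fin n) ≠ 0 := (Finset.mem_filter.1 (e.symm ⟨i, hi⟩).2).2
    simp only [hi, dif_pos]
    rw [dif_pos h1]
    simp
  · intro j hj
    rw [dif_pos hj]
    exact (e _).2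
  · intro j hj
    simp only [dif_pos hj]
    rw [dif_pos (e _).2]
    simp

section
variable {n : ℕ} {lam : Fin n → ℤ} {m : ℕ} (D : Dat lam m)

/-- A graded module and a split representation correspond to each other. -/
def Rel (M : GrMod (Qform n lam)) (V : Rp K (m + 1)) : Prop :=
  ∃ φ : M.carrier ≃ₗ[K] V.carrier,
    (∀ i < m, ∀ x, φ (tg lam (D.f i) • x) = D.s (D.f i) • V.T i (φ x)) ∧
    (∀ x ∈ M.g 0, V.T m (φ x) = φ x) ∧ (∀ x ∈ M.g 1, V.T m (φ x) = -φ x)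

lemma s_ne {i : ℕ} (hi : i < m) : D.s (D.f i) ≠ 0 := by
  rw [Ne, D.s_zero]
  exact D.f_ne i hi

lemma f_inj {i j : ℕ} (hi : i < m) (hj : j < m) (h : i ≠ j) : D.f i ≠ D.f j := by
  intro e
  apply h
  rw [← D.gf i hi, ← D.gf j hj, e]

lemma rel_of_mod (M : GrMod (Qform n lam)) : ∃ V, Rel D M V := by
  obtain ⟨ε, h0, h1⟩ := exists_parity M
  have hεsq : ∀ x, ε (ε x) = x := by
    intro x
    obtain ⟨x0, hx0, x1, hx1, rfl⟩ := decomp M x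
    simp [h0 _ hx0, h1 _ hx1]
  have hεt : ∀ j x, ε (tg lam j • x) = -(tg lam j • ε x) := by
    intro j x
    obtain ⟨x0, hx0, x1, hx1, rfl⟩ := decomp M x
    rw [smul_add, map_add, h1 _ (tg_mem0 M j hx0), h0 _ (tg_mem1 M j hx1), map_add, h0 _ hx0,
      h1 _ hx1, smul_add, smul_neg]
    abel
  let T : ℕ → M.carrier →ₗ[K] M.carrier := fun i =>
    if i < m then (D.s (D.f i))⁻¹ • Algebra.lsmul K K M.carrier (tg lam (D.f i)) else ε
  have hT : ∀ i < m, ∀ x, T i x = (D.s (D.f i))⁻¹ • (tg lam (D.f i) • x) := by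
    intro i hi x
    simp [T, hi]
  have hTm : T m = ε := by simp [T]
  let V : Rp K (m + 1) :=
    { carrier := M.carrier
      T := T
      sq := by
        intro i hi x
        by_cases h : i < m
        · rw [hT i h, hT i h, smul_comm (tg lam (D.f i)), tg_smul_sq, smul_smul, smul_smul,
            ← D.s_sq]
          have := s_ne D h
          have e : (D.s (D.f i))⁻¹ * ((D.s (D.f i))⁻¹ * (D.s (D.f i) * D.s (D.f i))) = 1 := by
            field_simp
          rw [← mul_assoc] at e
          rw [e, one_smul]
        · obtain rfl : i = m := by omega
          rw [hTm, hεsq]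
      anti := by
        intro i hi j hj hij x
        by_cases h : i < m <;> by_cases h' : j < m
        · rw [hT i h, hT j h', hT i h, hT j h', smul_comm (tg lam (D.f i)),
            tg_smul_anti M (f_inj D h h' hij), smul_comm (tg lam (D.f j)) (D.s (D.f i))⁻¹,
            smul_neg, smul_neg, smul_comm (D.s (D.f i))⁻¹]
        · obtain rfl : j = m := by omega
          rw [hTm, hT i h, hT i h, map_smul, hεt, smul_neg, neg_neg]
        · obtain rfl : i = m := by omega
          rw [hTm, hT j h', hT j h', map_smul, hεt, smul_neg]
        · omega }
  refine ⟨V, LinearEquiv.refl K M.carrier, ?_, ?_, ?_⟩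
  · intro i hi x
    change tg lam (D.f i) • x = D.s (D.f i) • T i x
    rw [hT i hi, smul_smul, mul_inv_cancel₀ (s_ne D hi), one_smul]
  · intro x hx
    change T m x = x
    rw [hTm, h0 x hx]
  · intro x hx
    change T m x = -x
    rw [hTm, h1 x hx]

lemma rel_of_rp (V : Rp K (m + 1)) : ∃ M, Rel D M V := by
  let U : Fin n → Module.End K V.carrier := fun j => D.s j • V.T (D.g j)
  have hU : ∀ j x, U j x = D.s j • V.T (D.g j) x := fun j x => rfl
  have hUsq : ∀ j, U j * U j = algebraMap K _ (cw (lam j)) := by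
    intro j
    ext x
    rw [Module.End.mul_apply, hU, hU, map_smul, smul_smul, D.s_sq, Module.algebraMap_end_apply]
    by_cases h : lam j = 0
    · rw [h, cw_zero, K_zero_smul, K_zero_smul]
    · rw [V.sq _ (by have := D.g_lt j h; omega)]
  have hUanti : ∀ j k, j ≠ k → U j * U k + U k * U j = 0 := by
    intro j k hjk
    ext x
    rw [LinearMap.add_apply, Module.End.mul_apply, Module.End.mul_apply, hU, hU, hU, hU,
      map_smul, map_smul, LinearMap.zero_apply]
    by_cases h : lam j = 0
    · rw [(D.s_zero j).2 h, K_zero_smul, K_zero_smul, smul_zero, add_zero]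
    by_cases h' : lam k = 0
    · rw [(D.s_zero k).2 h', K_zero_smul, K_zero_smul, smul_zero, add_zero]
    have := D.g_lt j h
    have := D.g_lt k h'
    rw [V.anti (D.g j) (by omega) (D.g k) (by omega) (by
      intro e
      apply hjk
      rw [← D.fg j h, ← D.fg k h', e]), smul_comm (D.s k)]
    simp
  have hUm : ∀ j x, V.T m (U j x) = -(U j (V.T m x)) := by
    intro j x
    rw [hU, hU, map_smul]
    by_cases h : lam j = 0
    · rw [(D.s_zero j).2 h, K_zero_smul, K_zero_smul, neg_zero]
    · have := D.g_lt j h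
      rw [V.anti m (by omega) (D.g j) (by omega) (by omega), smul_neg]
  let L : (Fin n → K) →ₗ[K] Module.End K V.carrier := Fintype.linearCombination K U
  have hLa : ∀ v, L v = ∑ j, v j • U j := fun v => Fintype.linearCombination_apply K U v
  have hL : ∀ v, L v * L v = algebraMap K _ (Qform n lam v) := by
    intro v
    have e1 : L v * L v = ∑ j, ∑ k, (v j * v k) • (U j * U k) := by
      rw [hLa, Finset.sum_mul_sum]
      refine Finset.sum_congr rfl fun j _ => Finset.sum_congr rfl fun k _ => ?_
      rw [smul_mul_smul_comm]
    have e2 : L v * L v = ∑ j, ∑ k, (v j * v k) • (U k * U j) := by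
      rw [e1, Finset.sum_comm]
      refine Finset.sum_congr rfl fun j _ => Finset.sum_congr rfl fun k _ => ?_
      rw [mul_comm (v k)]
    have e3 : L v * L v + L v * L v =
        algebraMap K _ (Qform n lam v) + algebraMap K _ (Qform n lam v) := by
      conv_lhs => rw [e1]
      conv_lhs => rw [← e1]
      nth_rewrite 1 [e1]
      rw [e2, ← Finset.sum_add_distrib, Qform_apply, map_sum, ← Finset.sum_add_distrib]
      refine Finset.sum_congr rfl fun j _ => ?_
      rw [← Finset.sum_add_distrib, Finset.sum_eq_single j]
      · rw [hUsq]
        exact congrArg₂ (· + ·) (smul_algebraMap_aux _ _) (smul_algebraMap_aux _ _)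
      · intro k _ hk
        rw [← smul_add, hUanti j k (Ne.symm hk), smul_zero]
      · simp
    have e4 : (2 : K) • (L v * L v) = (2 : K) • algebraMap K _ (Qform n lam v) := by
      rw [two_smul, two_smul, e3]
    exact smul_right_injective _ K_two_ne e4
  let A : CliffordAlgebra (Qform n lam) →ₐ[K] Module.End K V.carrier :=
    CliffordAlgebra.lift (Qform n lam) ⟨L, hL⟩
  have hAι : ∀ v, A (CliffordAlgebra.ι _ v) = L v := fun v => CliffordAlgebra.lift_ι_apply _ _ _
  have hAt : ∀ j, A (tg lam j) = U j := by
    intro j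
    rw [tg, hAι, hLa, Finset.sum_eq_single j]
    · simp
    · intro b _ hb
      rw [Pi.single_eq_of_ne hb, K_zero_smul]
    · simp
  have hinv : ∀ c x, V.T m (A c x) = A (CliffordAlgebra.involute c) (V.T m x) := by
    intro c
    induction c using CliffordAlgebra.induction with
    | algebraMap r =>
      intro x
      simp
    | ι v =>
      intro x
      rw [CliffordAlgebra.involute_ι, map_neg, hAι, hLa]
      simp [hUm]
    | mul a b ha hb =>
      intro x
      rw [map_mul, map_mul, map_mul, Module.End.mul_apply, ha, hb, Module.End.mul_apply]
    | add a b ha hb =>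
      intro x
      rw [map_add, map_add, map_add, LinearMap.add_apply, map_add, ha, hb, LinearMap.add_apply]
  let G : ZMod 2 → Submodule K V.carrier := fun a =>
    if a = 0 then LinearMap.ker (V.T m - LinearMap.id) else LinearMap.ker (V.T m + LinearMap.id)
  have hG0 : ∀ x, x ∈ G 0 ↔ V.T m x = x := by
    intro x; simp [G, sub_eq_zero]
  have hG1 : ∀ x, x ∈ G 1 ↔ V.T m x = -x := by
    intro x; simp [G, add_eq_zero_iff_eq_neg]
  have hsup : G 0 ⊔ G 1 = ⊤ := by
    rw [eq_top_iff]
    intro x _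
    rw [Submodule.mem_sup]
    refine ⟨(2 : K)⁻¹ • (x + V.T m x), ?_, (2 : K)⁻¹ • (x - V.T m x), ?_, ?_⟩
    · rw [hG0, map_smul, map_add, V.sq m (by omega), add_comm x]
    · rw [hG1, map_smul, map_sub, V.sq m (by omega), ← smul_neg, neg_sub]
    · rw [← smul_add]
      have : x + V.T m x + (x - V.T m x) = (2 : K) • x := by rw [two_smul]; abel
      rw [this, smul_smul, inv_mul_cancel₀ K_two_ne, one_smul]
  have hinf : G 0 ⊓ G 1 = ⊥ := by
    rw [eq_bot_iff]
    rintro x ⟨h0, h1⟩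
    have h0 := (hG0 x).1 h0
    have h1 := (hG1 x).1 h1
    rw [h0] at h1
    have : (2 : K) • x = 0 := by
      rw [two_smul]
      nth_rewrite 1 [h1]
      simp
    rw [Submodule.mem_bot]
    exact (smul_eq_zero.1 this).resolve_left K_two_ne
  have hsm : ∀ (a b : ZMod 2), ∀ c ∈ CliffordAlgebra.evenOdd (Qform n lam) a, ∀ x ∈ G b,
      A c x ∈ G (a + b) := by
    intro a b c hc x hx
    have h2 : ∀ z : ZMod 2, z = 0 ∨ z = 1 := by decide
    have h11 : (1 : ZMod 2) + 1 = 0 := by decide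
    rcases h2 a with rfl | rfl <;> rcases h2 b with rfl | rfl
    · rw [add_zero, hG0, hinv, CliffordAlgebra.involute_eq_of_mem_even hc, (hG0 x).1 hx]
    · rw [zero_add, hG1, hinv, CliffordAlgebra.involute_eq_of_mem_even hc, (hG1 x).1 hx, map_neg]
    · rw [add_zero, hG1, hinv, CliffordAlgebra.involute_eq_of_mem_odd hc, (hG0 x).1 hx, map_neg,
        LinearMap.neg_apply]
    · rw [h11, hG0, hinv, CliffordAlgebra.involute_eq_of_mem_odd hc, (hG1 x).1 hx, map_neg A,
        LinearMap.neg_apply, map_neg, neg_neg]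
  let modC : Module (CliffordAlgebra (Qform n lam)) V.carrier :=
    Module.compHom V.carrier A.toRingHom
  have hsmul : ∀ (c : CliffordAlgebra (Qform n lam)) (x : V.carrier), c • x = A c x :=
    fun c x => rfl
  have : IsScalarTower K (CliffordAlgebra (Qform n lam)) V.carrier := by
    refine ⟨fun k c x => ?_⟩
    rw [hsmul, hsmul, map_smul, LinearMap.smul_apply]
  let M : GrMod (Qform n lam) :=
    { carrier := V.carrier
      g := G
      sup_eq := hsup
      inf_eq := hinf
      smul_mem := hsm }
  refine ⟨M, LinearEquiv.refl K V.carrier, ?_, ?_, ?_⟩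
  · intro i hi x
    change A (tg lam (D.f i)) x = D.s (D.f i) • V.T i x
    rw [hAt, hU, D.gf i hi]
  · intro x hx
    exact (hG0 x).1 hx
  · intro x hx
    exact (hG1 x).1 hx

variable {D}

lemma Rel.finite {M : GrMod (Qform n lam)} {V : Rp K (m + 1)} (h : Rel D M V)
    (hV : Module.Finite K V.carrier) : FiniteDimensional K M.carrier := by
  obtain ⟨φ, -⟩ := h
  exact Module.Finite.equiv φ.symm

lemma Rel.finrank_eq {M : GrMod (Qform n lam)} {V : Rp K (m + 1)} (h : Rel D M V) :
    Module.finrank K M.carrier = Module.finrank K V.carrier := by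
  obtain ⟨φ, -⟩ := h
  exact φ.finrank_eq

lemma Rel.simple_mod {M : GrMod (Qform n lam)} {V : Rp K (m + 1)} (h : Rel D M V)
    (hV : V.Simple) : M.IsGradedSimple := by
  obtain ⟨φ, h1, h2, h3⟩ := h
  obtain ⟨⟨x, hx⟩, hs⟩ := hV
  refine ⟨⟨φ.symm x, by simpa using hx⟩, fun N hN => ?_⟩
  have key := hs ((N.restrictScalars K).map φ.toLinearMap) (by
    rintro i hi _ ⟨y, hy', rfl⟩
    have hyN : y ∈ N := hy'
    by_cases h : i < m
    · refine ⟨(D.s (D.f i))⁻¹ • (tg lam (D.f i) • y), ?_, ?_⟩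
      · exact (N.restrictScalars K).smul_mem _ (N.smul_mem _ hyN)
      · change φ _ = V.T i (φ y)
        rw [map_smul, h1 i h, smul_smul, inv_mul_cancel₀ (s_ne D h), one_smul]
    · obtain rfl : i = m := by omega
      obtain ⟨x0, x1, g0, g1, n0, n1, rfl⟩ := hN y hyN
      refine ⟨x0 - x1, N.sub_mem n0 n1, ?_⟩
      change φ (x0 - x1) = V.T i (φ (x0 + x1))
      rw [map_add, map_add, h2 _ g0, h3 _ g1, map_sub, sub_eq_add_neg])
  have aux : ∀ x, x ∈ N ↔ φ x ∈ (N.restrictScalars K).map φ.toLinearMap := by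
    intro x
    constructor
    · intro hx; exact ⟨x, hx, rfl⟩
    · rintro ⟨y, hy, hyx⟩
      have : y = x := φ.injective hyx
      rw [← this]; exact hy
  rcases key with h | h
  · left
    rw [eq_bot_iff]
    intro x hx
    rw [aux, h, Submodule.mem_bot] at hx
    rw [Submodule.mem_bot]
    simpa using hx
  · right
    rw [eq_top_iff]
    intro x _
    rw [aux, h]; trivial

lemma tg_cases (D : Dat lam m) {M : GrMod (Qform n lam)} (hM : M.IsGradedSimple)
    {P : Fin n → Prop} (h0 : ∀ j, lam j = 0 → P j) (h1 : ∀ i < m, P (D.f i)) (j : Fin n) : P j := by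
  by_cases h : lam j = 0
  · exact h0 j h
  · rw [← D.fg j h]
    exact h1 _ (D.g_lt j h)

lemma Rel.simple_rp {M : GrMod (Qform n lam)} {V : Rp K (m + 1)} (h : Rel D M V)
    (hM : M.IsGradedSimple) : V.Simple := by
  obtain ⟨φ, h1, h2, h3⟩ := h
  obtain ⟨x, hx⟩ := hM.1
  refine ⟨⟨φ x, by simpa using hx⟩, fun N hN => ?_⟩
  have hmem : ∀ x, x ∈ N.comap φ.toLinearMap ↔ φ x ∈ N := fun x => Iff.rfl
  have key := mkSub_cases M hM (N.comap φ.toLinearMap) (by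
    intro j
    refine tg_cases D hM (P := fun j => ∀ x ∈ N.comap φ.toLinearMap,
      tg lam j • x ∈ N.comap φ.toLinearMap) ?_ ?_ j
    · intro j hj x hx
      rw [kill M hM hj]
      exact Submodule.zero_mem _
    · intro i hi x hx
      rw [hmem, h1 i hi]
      exact N.smul_mem _ (hN i (by omega) _ hx)) (by
    intro x hx
    obtain ⟨x0, g0, x1, g1, rfl⟩ := decomp M x
    rw [hmem] at hx
    have hT := hN m (by omega) _ hx
    rw [map_add, map_add, h2 _ g0, h3 _ g1] at hT
    rw [map_add] at hx
    have n0 : φ x0 ∈ N := by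
      have := N.smul_mem (2 : K)⁻¹ (N.add_mem hx hT)
      have e : φ x0 + φ x1 + (φ x0 + -φ x1) = (2 : K) • φ x0 := by rw [two_smul]; abel
      rwa [e, smul_smul, inv_mul_cancel₀ K_two_ne, one_smul] at this
    have n1 : φ x1 ∈ N := by
      have := N.sub_mem hx n0
      rwa [add_sub_cancel_left] at this
    exact ⟨x0, x1, g0, g1, n0, n1, rfl⟩)
  rcases key with h | h
  · left
    rw [eq_bot_iff]
    intro y hy
    have : φ.symm y ∈ N.comap φ.toLinearMap := by rw [hmem]; simpa using hy
    rw [h] at this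
    simpa using this
  · right
    rw [eq_top_iff]
    intro y _
    have : φ.symm y ∈ N.comap φ.toLinearMap := by rw [h]; trivial
    rw [hmem] at this
    simpa using this

lemma mem_g_of {M : GrMod (Qform n lam)} {V : Rp K (m + 1)} (φ : M.carrier ≃ₗ[K] V.carrier)
    (h2 : ∀ x ∈ M.g 0, V.T m (φ x) = φ x) (h3 : ∀ x ∈ M.g 1, V.T m (φ x) = -φ x) (x : M.carrier) :
    (x ∈ M.g 0 ↔ V.T m (φ x) = φ x) ∧ (x ∈ M.g 1 ↔ V.T m (φ x) = -φ x) := by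
  have half : ∀ y : M.carrier, φ y + φ y = 0 → y = 0 := by
    intro y hy
    rw [← two_smul K] at hy
    simpa using (smul_eq_zero.1 hy).resolve_left K_two_ne
  refine ⟨⟨h2 x, fun h => ?_⟩, ⟨h3 x, fun h => ?_⟩⟩
  · obtain ⟨x0, g0, x1, g1, rfl⟩ := decomp M x
    rw [map_add, map_add, h2 _ g0, h3 _ g1] at h
    have : φ x1 + φ x1 = 0 := by
      have h' := add_left_cancel h
      nth_rewrite 1 [← h']
      simp
    rw [half _ this, add_zero]
    exact g0
  · obtain ⟨x0, g0, x1, g1, rfl⟩ := decomp M x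
    rw [map_add, map_add, h2 _ g0, h3 _ g1, neg_add] at h
    have : φ x0 + φ x0 = 0 := by
      have h' := add_right_cancel h
      nth_rewrite 1 [h']
      simp
    rw [half _ this, zero_add]
    exact g1

lemma Rel.iso_rp {M M' : GrMod (Qform n lam)} {V V' : Rp K (m + 1)} (h : Rel D M V)
    (h' : Rel D M' V') (hi : M.Iso M') : V.Iso V' := by
  obtain ⟨φ, h1, h2, h3⟩ := h
  obtain ⟨φ', h1', h2', h3'⟩ := h'
  obtain ⟨e, he⟩ := hi
  refine ⟨(φ.symm.trans (e.restrictScalars K)).trans φ', ?_⟩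
  intro i hi y
  obtain ⟨x, rfl⟩ := φ.surjective y
  simp only [LinearEquiv.trans_apply, LinearEquiv.symm_apply_apply,
    LinearEquiv.restrictScalars_apply]
  by_cases h : i < m
  · have e1 : V.T i (φ x) = φ ((D.s (D.f i))⁻¹ • (tg lam (D.f i) • x)) := by
      rw [map_smul, h1 i h, smul_smul, inv_mul_cancel₀ (s_ne D h), one_smul]
    rw [e1, φ.symm_apply_apply]
    have e2 : e ((D.s (D.f i))⁻¹ • (tg lam (D.f i) • x))
        = (D.s (D.f i))⁻¹ • (tg lam (D.f i) • e x) := by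
      rw [← map_smul]
      exact (e.restrictScalars K).map_smul _ _
    rw [e2, map_smul, h1' i h, smul_smul, inv_mul_cancel₀ (s_ne D h), one_smul]
  · obtain rfl : i = m := by omega
    obtain ⟨x0, g0, x1, g1, rfl⟩ := decomp M x
    have e1 : V.T i (φ (x0 + x1)) = φ (x0 - x1) := by
      rw [map_add, map_add, h2 _ g0, h3 _ g1, map_sub, sub_eq_add_neg]
    rw [e1, φ.symm_apply_apply, map_sub, map_add, map_sub, map_add, map_add,
      h2' _ ((he 0 x0).1 g0), h3' _ ((he 1 x1).1 g1), sub_eq_add_neg]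

lemma Rel.iso_mod {M M' : GrMod (Qform n lam)} {V V' : Rp K (m + 1)} (h : Rel D M V)
    (h' : Rel D M' V') (hM : M.IsGradedSimple) (hM' : M'.IsGradedSimple)
    (hi : V.Iso V') : M.Iso M' := by
  obtain ⟨φ, h1, h2, h3⟩ := h
  obtain ⟨φ', h1', h2', h3'⟩ := h'
  obtain ⟨e, he⟩ := hi
  let ψ : M.carrier ≃ₗ[K] M'.carrier := (φ.trans e).trans φ'.symm
  have hψ : ∀ x, φ' (ψ x) = e (φ x) := by intro x; simp [ψ]
  have ht : ∀ j x, ψ (tg lam j • x) = tg lam j • ψ x := by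
    intro j
    refine tg_cases D hM (P := fun j => ∀ x, ψ (tg lam j • x) = tg lam j • ψ x) ?_ ?_ j
    · intro j hj x
      rw [kill M hM hj, kill M' hM' hj, map_zero]
    · intro i hi x
      apply φ'.injective
      rw [hψ, h1 i hi, h1' i hi, map_smul, he i (by omega), hψ]
  have hc : ∀ (c : CliffordAlgebra (Qform n lam)) x, ψ (c • x) = c • ψ x := by
    intro c
    induction c using CliffordAlgebra.induction with
    | algebraMap r => intro x; rw [algebraMap_smul, algebraMap_smul, map_smul]
    | ι v =>
      intro x
      rw [iota_expand, Finset.sum_smul, Finset.sum_smul, map_sum]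
      refine Finset.sum_congr rfl fun j _ => ?_
      rw [smul_assoc, smul_assoc, map_smul, ht]
    | mul a b ha hb => intro x; rw [mul_smul, mul_smul, ha, hb]
    | add a b ha hb => intro x; rw [add_smul, add_smul, map_add, ha, hb]
  refine ⟨{ ψ with map_smul' := hc }, ?_⟩
  intro a x
  change x ∈ M.g a ↔ ψ x ∈ M'.g a
  have hz : ∀ z : ZMod 2, z = 0 ∨ z = 1 := by decide
  have k := mem_g_of φ h2 h3 x
  have k' := mem_g_of φ' h2' h3' (ψ x)
  rcases hz a with rfl | rfl
  · rw [k.1, k'.1, hψ, ← he m (by omega)]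
    exact e.injective.eq_iff.symm
  · rw [k.2, k'.2, hψ, ← he m (by omega), ← map_neg e]
    exact e.injective.eq_iff.symm

lemma finrank_half (D : Dat lam m) (hm1 : 1 ≤ m) (M : GrMod (Qform n lam))
    (hf : FiniteDimensional K M.carrier) (d : ℕ)
    (hd : Module.finrank K M.carrier = 2 * d) :
    Module.finrank K (M.g 0) = d ∧ Module.finrank K (M.g 1) = d := by
  have hc : IsCompl (M.g 0) (M.g 1) :=
    ⟨disjoint_iff.2 M.inf_eq, codisjoint_iff.2 M.sup_eq⟩
  have h1 := Submodule.finrank_add_eq_of_isCompl hc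
  let t := tg lam (D.f 0)
  have hinj : ∀ x : M.carrier, t • x = 0 → x = 0 := by
    intro x hx
    have h : t • t • x = cw (lam (D.f 0)) • x := tg_smul_sq M _ x
    rw [hx, smul_zero, ← D.s_sq] at h
    have h0 := s_ne D (i := 0) (by omega)
    exact (smul_eq_zero.1 h.symm).resolve_left (mul_ne_zero h0 h0)
  let L := Algebra.lsmul K K M.carrier t
  have l01 : Module.finrank K (M.g 0) ≤ Module.finrank K (M.g 1) := by
    refine LinearMap.finrank_le_finrank_of_injective
      (f := L.restrict (p := M.g 0) (q := M.g 1) (fun x hx => tg_mem0 M _ hx)) ?_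
    rw [injective_iff_map_eq_zero]
    intro x hx
    exact Subtype.ext (hinj x (congrArg Subtype.val hx))
  have l10 : Module.finrank K (M.g 1) ≤ Module.finrank K (M.g 0) := by
    refine LinearMap.finrank_le_finrank_of_injective
      (f := L.restrict (p := M.g 1) (q := M.g 0) (fun x hx => tg_mem1 M _ hx)) ?_
    rw [injective_iff_map_eq_zero]
    intro x hx
    exact Subtype.ext (hinj x (congrArg Subtype.val hx))
  omega

end

/-- For `λ ∈ ℤⁿ` with `m ≥ 1` nonzero entries, the quantum Clifford algebra `Cliff_q(λ)`
over `K = ℂ((q))`: (1) has a finite-dimensional graded-simple graded module; (2) every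
finite-dimensional graded-simple graded module `M` satisfies
`dim_K M₀ = dim_K M₁ = 2^{⌈m/2⌉−1}`; and (3) for `m` odd all finite-dimensional
graded-simple graded modules are isomorphic, while for `m` even there are exactly two
isomorphism classes of them. -/
theorem quantum_clifford_simple_modules (n : ℕ) (lam : Fin n → ℤ) (m : ℕ)
    (hm : m = (Finset.univ.filter (fun i => lam i ≠ 0)).card) (hm1 : 1 ≤ m) :
    (∃ M : GrMod (Qform n lam), FiniteDimensional K M.carrier ∧ M.IsGradedSimple) ∧
    (∀ M : GrMod (Qform n lam), FiniteDimensional K M.carrier → M.IsGradedSimple →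
      Module.finrank K (M.g 0) = 2 ^ ((m + 1) / 2 - 1) ∧
      Module.finrank K (M.g 1) = 2 ^ ((m + 1) / 2 - 1)) ∧
    (Odd m → ∀ M M' : GrMod (Qform n lam),
      FiniteDimensional K M.carrier → M.IsGradedSimple →
      FiniteDimensional K M'.carrier → M'.IsGradedSimple → M.Iso M') ∧
    (Even m → ∃ M M' : GrMod (Qform n lam),
      FiniteDimensional K M.carrier ∧ M.IsGradedSimple ∧
      FiniteDimensional K M'.carrier ∧ M'.IsGradedSimple ∧ ¬ M.Iso M' ∧
      ∀ M'' : GrMod (Qform n lam), FiniteDimensional K M''.carrier → M''.IsGradedSimple →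
        (M''.Iso M ∨ M''.Iso M')) := by
  obtain ⟨D⟩ := exists_dat lam m hm hm1
  obtain ⟨I, hI⟩ := exists_I
  rcases Nat.even_or_odd m with hev | hodd
  · obtain ⟨k, hk⟩ := hev
    have hk2 : m = 2 * k := by omega
    subst hk2
    obtain ⟨S, S', hS, hS', hf, hf', hd, hd', hn, hu⟩ := Rp.classify_odd I hI K_two_ne k
    obtain ⟨M, hM⟩ := rel_of_rp D S
    obtain ⟨M', hM'⟩ := rel_of_rp D S'
    have sM := hM.simple_mod hS
    have sM' := hM'.simple_mod hS'
    refine ⟨⟨M, hM.finite hf, sM⟩, ?_, ?_, ?_⟩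
    · intro N hN sN
      obtain ⟨V, hV⟩ := rel_of_mod D N
      have hfr : Module.finrank K N.carrier = 2 ^ k := by
        rw [hV.finrank_eq]
        rcases hu V (hV.simple_rp sN) with h | h
        · rw [h.finrank_eq, hd]
        · rw [h.finrank_eq, hd']
      refine finrank_half D hm1 N hN _ ?_
      rw [hfr, ← pow_succ']
      congr 1
      omega
    · intro ho
      exact absurd ho (by simp)
    · intro _
      refine ⟨M, M', hM.finite hf, sM, hM'.finite hf', sM', ?_, ?_⟩
      · exact fun h => hn (hM.iso_rp hM' h)
      · intro N hN sN
        obtain ⟨V, hV⟩ := rel_of_mod D N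
        rcases hu V (hV.simple_rp sN) with h | h
        · exact Or.inl (hV.iso_mod hM sN sM h)
        · exact Or.inr (hV.iso_mod hM' sN sM' h)
  · obtain ⟨k, hk⟩ := hodd
    obtain ⟨S, hS, hf, hd, hu⟩ : ∃ S : Rp K (m + 1), S.Simple ∧ Module.Finite K S.carrier ∧
        Module.finrank K S.carrier = 2 ^ (k + 1) ∧ ∀ V : Rp K (m + 1), V.Simple → V.Iso S := by
      subst hk
      exact Rp.classify_even I hI K_two_ne (k + 1)
    obtain ⟨M, hM⟩ := rel_of_rp D S
    refine ⟨⟨M, hM.finite hf, hM.simple_mod hS⟩, ?_, ?_, ?_⟩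
    · intro N hN sN
      obtain ⟨V, hV⟩ := rel_of_mod D N
      refine finrank_half D hm1 N hN _ ?_
      rw [hV.finrank_eq, (hu V (hV.simple_rp sN)).finrank_eq, hd, ← pow_succ']
      congr 1
      omega
    · intro _ N N' hN sN hN' sN'
      obtain ⟨V, hV⟩ := rel_of_mod D N
      obtain ⟨V', hV'⟩ := rel_of_mod D N'
      exact hV.iso_mod hV' sN sN'
        ((hu V (hV.simple_rp sN)).trans (hu V' (hV'.simple_rp sN')).symm)
    · intro he
      exact absurd he (by rw [Nat.not_even_iff_odd]; exact ⟨k, hk⟩)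

end QueerClifford
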